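/- arXiv:2212.11697 — 5 statements merged into one kernel-verified Lean document; each statement's English description precedes it below -/
import Mathlib

section
/- The expectation of the p-censoring Y of X satisfies E[Y] ≤ E[T_p − 1] = (1−p)/p; in particular E[Y] is finite even when E[X] is infinite. -/
open MeasureTheory ProbabilityTheory

/-- Two probability measures on a countable space are equal as soon as they agree on all
singletons but one. -/
lemma MeasureTheory.Measure.ext_of_singleton_of_ne {α : Type*} [MeasurableSpace α] [Countable α]
    [MeasurableSingletonClass α] {μ ν : Measure α} [IsProbabilityMeasure μ]
    [IsProbabilityMeasure ν] (a : α) (h : ∀ b, b ≠ a → μ {b} = ν {b}) : μ = ν := by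
  have hrestrict : μ.restrict {a}ᶜ = ν.restrict {a}ᶜ := by
    refine Measure.ext_of_singleton fun b ↦ ?_
    rw [Measure.restrict_apply (measurableSet_singleton b),
      Measure.restrict_apply (measurableSet_singleton b)]
    by_cases hb : b = a
    · simp [hb]
    · rw [Set.inter_eq_left.2 (by simpa using Ne.symm hb), h b hb]
  have hcompl : μ {a}ᶜ = ν {a}ᶜ := by
    simpa using congrArg (fun m : Measure α ↦ m Set.univ) hrestrict
  refine Measure.ext_of_singleton fun b ↦ ?_
  by_cases hb : b = a
  · subst hb
    rw [← compl_compl ({b} : Set α), prob_compl_eq_one_sub (measurableSet_singleton b).compl,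
      prob_compl_eq_one_sub (measurableSet_singleton b).compl, hcompl]
  · exact h b hb

namespace ProbabilityTheory

/-- The terms of the series computing the mean of the geometric distribution. -/
lemma hasSum_geometricMeasure_mul_coe {p : ℝ} (hp : p ∈ Set.Ioo (0 : ℝ) 1) :
    HasSum (fun n : ℕ ↦ (1 - p) ^ n * p * (n : ℝ)) ((1 - p) / p) := by
  have hp0 : p ≠ 0 := hp.1.ne'
  have hr : ‖1 - p‖ < 1 := by
    rw [Real.norm_eq_abs, abs_lt]
    constructor <;> linarith [hp.1, hp.2]
  convert! (hasSum_coe_mul_geometric_of_norm_lt_one hr).mul_left p using 1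
  · ext n; ring
  · rw [sub_sub_cancel]
    field_simp

lemma integrable_coe_geometricMeasure {p : unitInterval} (hp : (p : ℝ) ∈ Set.Ioo (0 : ℝ) 1) :
    Integrable (fun n : ℕ ↦ (n : ℝ)) (geometricMeasure p) := by
  rw [integrable_geometricMeasure_iff (unitInterval.coe_ne_zero.1 hp.1.ne')]
  simpa using (hasSum_geometricMeasure_mul_coe hp).summable

lemma integral_coe_geometricMeasure {p : unitInterval} (hp : (p : ℝ) ∈ Set.Ioo (0 : ℝ) 1) :
    ∫ n : ℕ, (n : ℝ) ∂geometricMeasure p = (1 - p) / p := by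
  rw [integral_geometricMeasure (unitInterval.coe_ne_zero.1 hp.1.ne')]
  simpa using (hasSum_geometricMeasure_mul_coe hp).tsum_eq

/-- A variable with the geometric mass function on the positive integers is distributed as one
plus a variable with the geometric distribution on the natural numbers. -/
lemma map_eq_map_succ_geometricMeasure {Ω : Type*} [MeasurableSpace Ω] {P : Measure Ω}
    [IsProbabilityMeasure P] {T : Ω → ℕ} (hT : Measurable T) {p : unitInterval} (hp : p ≠ 0)
    (hTpmf : ∀ n : ℕ, 1 ≤ n →
      (P {ω | T ω = n}).toReal = (p : ℝ) * (1 - (p : ℝ)) ^ (n - 1)) :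
    P.map T = (geometricMeasure p).map Nat.succ := by
  have := Measure.isProbabilityMeasure_map (μ := P) hT.aemeasurable
  have := Measure.isProbabilityMeasure_map (μ := geometricMeasure p) (f := Nat.succ)
    Measurable.of_discrete.aemeasurable
  refine Measure.ext_of_singleton_of_ne 0 fun n hn ↦ ?_
  obtain ⟨k, rfl⟩ := Nat.exists_eq_succ_of_ne_zero hn
  have hpre : Nat.succ ⁻¹' {k.succ} = {k} := by ext; simp
  rw [Measure.map_apply hT (measurableSet_singleton _),
    Measure.map_apply Measurable.of_discrete (measurableSet_singleton _), hpre,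
    geometricMeasure_singleton hp, mul_comm, ← ENNReal.ofReal_toReal (measure_ne_top P _)]
  exact congrArg ENNReal.ofReal (hTpmf k.succ (Nat.succ_pos k))

end ProbabilityTheory


/-- The expectation of the `p`-censoring `Y` of `X` is finite and satisfies
`E[Y] ≤ E[T_p - 1] = (1-p)/p`. -/
theorem censoring_expectation_le
    {Ω : Type*} [MeasurableSpace Ω] (P : Measure Ω) [IsProbabilityMeasure P]
    (X T : Ω → ℕ) (hX : Measurable X) (hT : Measurable T)
    (p : ℝ) (hp : p ∈ Set.Ioo (0 : ℝ) 1)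
    (hTpmf : ∀ n : ℕ, 1 ≤ n → (P {ω | T ω = n}).toReal = p * (1 - p) ^ (n - 1))
    (hindep : IndepFun X T P)
    (Y : Ω → ℕ) (hY : ∀ ω, Y ω = if X ω < T ω then X ω else 0) :
    Integrable (fun ω => (Y ω : ℝ)) P
      ∧ Integrable (fun ω => (T ω : ℝ) - 1) P
      ∧ (∫ ω, (Y ω : ℝ) ∂P) ≤ ∫ ω, ((T ω : ℝ) - 1) ∂P
      ∧ (∫ ω, ((T ω : ℝ) - 1) ∂P) = (1 - p) / p := by
  let q : unitInterval := ⟨p, hp.1.le, hp.2.le⟩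
  have hq : (q : ℝ) ∈ Set.Ioo (0 : ℝ) 1 := hp
  have hmap : P.map T = (geometricMeasure q).map Nat.succ :=
    map_eq_map_succ_geometricMeasure hT (unitInterval.coe_ne_zero.1 hq.1.ne') hTpmf
  have hmeas : ∀ {μ : Measure ℕ}, AEStronglyMeasurable (fun n : ℕ ↦ (n : ℝ) - 1) μ :=
    Measurable.of_discrete.aestronglyMeasurable
  have hsucc : AEMeasurable Nat.succ (geometricMeasure q) := Measurable.of_discrete.aemeasurable
  have hTint : Integrable (fun ω ↦ (T ω : ℝ) - 1) P := by
    refine (integrable_map_measure hmeas hT.aemeasurable).1 ?_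
    rw [hmap, integrable_map_measure hmeas hsucc]
    simpa [Function.comp_def] using integrable_coe_geometricMeasure hq
  have hTmean : ∫ ω, ((T ω : ℝ) - 1) ∂P = (1 - p) / p := by
    rw [← integral_map (f := fun n : ℕ ↦ (n : ℝ) - 1) hT.aemeasurable hmeas, hmap,
      integral_map hsucc hmeas]
    simpa using integral_coe_geometricMeasure hq
  have hTpos : ∀ᵐ ω ∂P, 0 < T ω := by
    refine ae_of_ae_map hT.aemeasurable (p := fun n ↦ 0 < n) ?_
    rw [hmap, ae_map_iff hsucc (MeasurableSet.of_discrete)]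
    exact Filter.Eventually.of_forall Nat.succ_pos
  have hYle : ∀ᵐ ω ∂P, (Y ω : ℝ) ≤ (T ω : ℝ) - 1 := by
    filter_upwards [hTpos] with ω hω
    have hle : Y ω + 1 ≤ T ω := by
      rw [hY]
      split_ifs <;> omega
    exact le_sub_iff_add_le.2 (mod_cast hle)
  have hYmeas : Measurable Y := by
    rw [funext hY]
    exact Measurable.ite (measurableSet_lt hX hT) hX measurable_const
  have hYint : Integrable (fun ω ↦ (Y ω : ℝ)) P := by
    refine hTint.mono' (measurable_from_nat.comp hYmeas).aestronglyMeasurable ?_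
    simpa using hYle
  exact ⟨hYint, hTint, integral_mono_ae hYint hTint hYle, hTmean⟩
end

section
/- If X has distribution DS(a,λ) and Y is the p-censoring of X for some p ∈ (0,1), then E[Y] = a·λ·p^{a−1}·(1−p)·exp(−λ p^a). -/
open MeasureTheory ProbabilityTheory

/-- The tail of the geometric distribution on the positive integers. -/
lemma measure_lt_of_geometric {Ω : Type*} [MeasurableSpace Ω] {P : Measure Ω}
    [IsProbabilityMeasure P] {T : Ω → ℕ} (hT : Measurable T) {p : ℝ} (hp : p ∈ Set.Ioo (0 : ℝ) 1)
    (hTpmf : ∀ n : ℕ, 1 ≤ n → (P {ω | T ω = n}).toReal = p * (1 - p) ^ (n - 1)) (n : ℕ) :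
    P {ω | n < T ω} = ENNReal.ofReal ((1 - p) ^ n) := by
  have hq0 : 0 ≤ 1 - p := by linarith [hp.2]
  have hunion : {ω | n < T ω} = ⋃ k : ℕ, {ω | T ω = n + k + 1} := by
    ext ω
    simp only [Set.mem_ofPred_eq, Set.mem_iUnion]
    exact ⟨fun h => ⟨T ω - n - 1, by omega⟩, fun ⟨k, hk⟩ => by omega⟩
  have hdisj : Pairwise (Function.onFun Disjoint fun k : ℕ => {ω | T ω = n + k + 1}) := by
    intro i j hij
    refine Set.disjoint_left.2 fun ω hi hj => hij ?_
    simp only [Set.mem_ofPred_eq] at hi hj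
    omega
  have hterm (k : ℕ) :
      P {ω | T ω = n + k + 1} = ENNReal.ofReal (p * (1 - p) ^ n * (1 - p) ^ k) := by
    rw [← ENNReal.ofReal_toReal (measure_ne_top P _), hTpmf _ (by omega), mul_assoc, ← pow_add,
      Nat.add_sub_cancel]
  have hsum : HasSum (fun k : ℕ => p * (1 - p) ^ n * (1 - p) ^ k) ((1 - p) ^ n) := by
    have h := (hasSum_geometric_of_lt_one hq0 (by linarith [hp.1])).mul_left (p * (1 - p) ^ n)
    rwa [sub_sub_cancel, mul_right_comm, mul_inv_cancel₀ hp.1.ne', one_mul] at h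
  rw [hunion, measure_iUnion hdisj fun k => hT (measurableSet_singleton _)]
  simp_rw [hterm]
  rw [← ENNReal.ofReal_tsum_of_nonneg _ hsum.summable, hsum.tsum_eq]
  intro k
  have := hp.1.le
  positivity

lemma nat_mul_pow_sub_one_le {r : ℝ} (h0 : 0 ≤ r) (h1 : r < 1) (n : ℕ) :
    n * r ^ (n - 1) ≤ (1 - r)⁻¹ := by
  calc (n : ℝ) * r ^ (n - 1) = ∑ _i ∈ Finset.range n, r ^ (n - 1) := by simp
    _ ≤ ∑ i ∈ Finset.range n, r ^ i := by
        refine Finset.sum_le_sum fun i hi => pow_le_pow_of_le_one h0 h1.le ?_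
        have := Finset.mem_range.1 hi
        omega
    _ ≤ ∑' i : ℕ, r ^ i :=
        (summable_geometric_of_lt_one h0 h1).sum_le_tsum _ fun i _ => pow_nonneg h0 i
    _ = (1 - r)⁻¹ := tsum_geometric_of_lt_one h0 h1

/-- A probability generating function may be differentiated under the expectation
inside the unit interval. -/
lemma hasDerivAt_integral_pow {Ω : Type*} [MeasurableSpace Ω] {P : Measure Ω}
    [IsProbabilityMeasure P] {X : Ω → ℕ} (hX : Measurable X) {q : ℝ}
    (hq : q ∈ Set.Ioo (0 : ℝ) 1) :
    Integrable (fun ω => (X ω : ℝ) * q ^ (X ω - 1)) P ∧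
      HasDerivAt (fun s : ℝ => ∫ ω, s ^ X ω ∂P) (∫ ω, (X ω : ℝ) * q ^ (X ω - 1) ∂P) q := by
  have hr1 : (1 + q) / 2 < 1 := by linarith [hq.2]
  have hr0 : 0 ≤ (1 + q) / 2 := by linarith [hq.1]
  have hmeas (f : ℕ → ℝ) : AEStronglyMeasurable (fun ω => f (X ω)) P :=
    ((measurable_of_countable f).comp hX).aestronglyMeasurable
  refine hasDerivAt_integral_of_dominated_loc_of_deriv_le
    (F' := fun s ω => (X ω : ℝ) * s ^ (X ω - 1)) (s := Set.Ioo 0 ((1 + q) / 2))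
    (bound := fun _ => (1 - (1 + q) / 2)⁻¹)
    (Ioo_mem_nhds hq.1 (by linarith [hq.2]))
    (Filter.Eventually.of_forall fun s => hmeas fun n => s ^ n) ?_
    (hmeas fun n => (n : ℝ) * q ^ (n - 1)) ?_ (integrable_const _) ?_
  · refine Integrable.of_bound (hmeas fun n => q ^ n) 1 (Filter.Eventually.of_forall fun ω => ?_)
    rw [Real.norm_of_nonneg (pow_nonneg hq.1.le _)]
    exact pow_le_one₀ hq.1.le hq.2.le
  · refine Filter.Eventually.of_forall fun ω s hs => ?_
    have hs0 := hs.1.le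
    rw [Real.norm_of_nonneg (by positivity)]
    refine le_trans ?_ (nat_mul_pow_sub_one_le hr0 hr1 (X ω))
    gcongr
    exact hs.2.le
  · exact Filter.Eventually.of_forall fun ω s _ => hasDerivAt_pow _ _

/-- Censoring by an independent geometric variable has the same effect on the mean as weighting
by the geometric tail. -/
lemma lintegral_censoring {Ω : Type*} [MeasurableSpace Ω] {P : Measure Ω}
    [IsProbabilityMeasure P] {X T : Ω → ℕ} (hX : Measurable X) (hT : Measurable T) {p : ℝ}
    (hp : p ∈ Set.Ioo (0 : ℝ) 1)
    (hTpmf : ∀ n : ℕ, 1 ≤ n → (P {ω | T ω = n}).toReal = p * (1 - p) ^ (n - 1))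
    (hindep : IndepFun X T P) :
    ∫⁻ ω, ENNReal.ofReal ((if X ω < T ω then X ω else 0 : ℕ) : ℝ) ∂P
      = ∫⁻ ω, ENNReal.ofReal ((X ω : ℝ) * (1 - p) ^ X ω) ∂P := by
  let F : ℕ × ℕ → ENNReal := fun z => ENNReal.ofReal ((if z.1 < z.2 then z.1 else 0 : ℕ) : ℝ)
  have hF : Measurable F := measurable_of_countable F
  have hinner (x : ℕ) : ∫⁻ t, F (x, t) ∂(P.map T) = ENNReal.ofReal ((x : ℝ) * (1 - p) ^ x) := by
    have hind : (fun t => F (x, t)) = (Set.Ioi x).indicator fun _ => ENNReal.ofReal (x : ℝ) := by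
      ext t
      by_cases h : x < t <;> simp [F, h]
    rw [hind, lintegral_indicator_const measurableSet_Ioi, Measure.map_apply hT measurableSet_Ioi,
      ENNReal.ofReal_mul (Nat.cast_nonneg x), ← measure_lt_of_geometric hT hp hTpmf x]
    rfl
  calc ∫⁻ ω, ENNReal.ofReal ((if X ω < T ω then X ω else 0 : ℕ) : ℝ) ∂P
      = ∫⁻ z, F z ∂(P.map fun ω => (X ω, T ω)) := (lintegral_map hF (hX.prodMk hT)).symm
    _ = ∫⁻ x, ∫⁻ t, F (x, t) ∂(P.map T) ∂(P.map X) := by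
        have := Measure.isProbabilityMeasure_map (μ := P) hT.aemeasurable
        rw [(indepFun_iff_map_prod_eq_prod_map_map hX.aemeasurable hT.aemeasurable).1 hindep,
          lintegral_prod _ hF.aemeasurable]
    _ = ∫⁻ ω, ENNReal.ofReal ((X ω : ℝ) * (1 - p) ^ X ω) ∂P := by
        simp_rw [hinner]
        exact lintegral_map (measurable_of_countable _) hX

/-- If `X ∼ DS(a,λ)` and `Y` is the `p`-censoring of `X`, then
`E[Y] = a λ p^{a-1} (1-p) exp(-λ p^a)`. -/
theorem censoring_mean_discrete_stable
    {Ω : Type*} [MeasurableSpace Ω] (P : Measure Ω) [IsProbabilityMeasure P]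
    (a lam : ℝ) (ha : a ∈ Set.Ioc (0 : ℝ) 1) (hlam : 0 < lam)
    (X T : Ω → ℕ) (hX : Measurable X) (hT : Measurable T)
    (hpgf : ∀ s ∈ Set.Icc (0 : ℝ) 1,
      (∫ ω, s ^ (X ω) ∂P) = Real.exp (-lam * (1 - s) ^ a))
    (p : ℝ) (hp : p ∈ Set.Ioo (0 : ℝ) 1)
    (hTpmf : ∀ n : ℕ, 1 ≤ n → (P {ω | T ω = n}).toReal = p * (1 - p) ^ (n - 1))
    (hindep : IndepFun X T P)
    (Y : Ω → ℕ) (hY : ∀ ω, Y ω = if X ω < T ω then X ω else 0) :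
    Integrable (fun ω => (Y ω : ℝ)) P
      ∧ (∫ ω, (Y ω : ℝ) ∂P)
          = a * lam * p ^ (a - 1) * (1 - p) * Real.exp (-lam * p ^ a) := by
  have hq : 1 - p ∈ Set.Ioo (0 : ℝ) 1 := ⟨by linarith [hp.2], by linarith [hp.1]⟩
  obtain ⟨hint, hderiv⟩ := hasDerivAt_integral_pow (P := P) hX hq
  have hexp : HasDerivAt (fun s : ℝ => Real.exp (-lam * (1 - s) ^ a))
      (a * lam * p ^ (a - 1) * Real.exp (-lam * p ^ a)) (1 - p) := by
    have h1 : HasDerivAt (fun s : ℝ => 1 - s) (-1) (1 - p) := (hasDerivAt_id _).const_sub 1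
    have h2 := ((h1.rpow_const (p := a) (Or.inl (by linarith [hp.1]))).const_mul (-lam)).exp
    rw [sub_sub_cancel] at h2
    convert h2 using 1
    ring
  have hmean : ∫ ω, (X ω : ℝ) * (1 - p) ^ (X ω - 1) ∂P
      = a * lam * p ^ (a - 1) * Real.exp (-lam * p ^ a) := by
    refine hderiv.unique (hexp.congr_of_eventuallyEq ?_)
    filter_upwards [Ioo_mem_nhds hq.1 hq.2] with s hs
    exact hpgf s (Set.Ioo_subset_Icc_self hs)
  have hpow (n : ℕ) : (n : ℝ) * (1 - p) ^ n = (1 - p) * (n * (1 - p) ^ (n - 1)) := by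
    cases n with
    | zero => simp
    | succ n => rw [Nat.add_sub_cancel]; ring
  have hweighted : Integrable (fun ω => (X ω : ℝ) * (1 - p) ^ X ω) P := by
    simp_rw [hpow]
    exact hint.const_mul _
  have hY0 : 0 ≤ᵐ[P] fun ω => (Y ω : ℝ) := Filter.Eventually.of_forall fun ω => Nat.cast_nonneg _
  have hW0 : 0 ≤ᵐ[P] fun ω => (X ω : ℝ) * (1 - p) ^ X ω :=
    Filter.Eventually.of_forall fun ω => mul_nonneg (Nat.cast_nonneg _) (pow_nonneg hq.1.le _)
  have hYmeas : AEStronglyMeasurable (fun ω => (Y ω : ℝ)) P := by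
    simp_rw [hY]
    exact ((measurable_of_countable fun z : ℕ × ℕ =>
      ((if z.1 < z.2 then z.1 else 0 : ℕ) : ℝ)).comp (hX.prodMk hT)).aestronglyMeasurable
  have hlint : ∫⁻ ω, ENNReal.ofReal (Y ω : ℝ) ∂P
      = ∫⁻ ω, ENNReal.ofReal ((X ω : ℝ) * (1 - p) ^ X ω) ∂P := by
    simp_rw [hY]
    exact lintegral_censoring hX hT hp hTpmf hindep
  refine ⟨⟨hYmeas, (hasFiniteIntegral_iff_ofReal hY0).2 ?_⟩, ?_⟩
  · rw [hlint]
    exact (hasFiniteIntegral_iff_ofReal hW0).1 hweighted.2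
  · rw [integral_eq_lintegral_of_nonneg_ae hY0 hYmeas, hlint,
      ← integral_eq_lintegral_of_nonneg_ae hW0 hweighted.1]
    simp_rw [hpow]
    rw [integral_const_mul, hmean]
    ring
end

section
/- If X has distribution DS(a,λ) and Y is the p-censoring of X for some p ∈ (0,1), then E[Y] = −a·p^{−1}·(1−p)·g(1−p)·log g(1−p), where g(1−p) = exp(−λ p^a) is the probability generating function of X evaluated at 1−p. -/
open MeasureTheory ProbabilityTheory

/-- The tail of the geometric distribution on the positive integers. -/
theorem measureReal_lt_of_geometric {Ω : Type*} [MeasurableSpace Ω] (P : Measure Ω)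
    [IsProbabilityMeasure P] {T : Ω → ℕ} (hT : Measurable T) {p : ℝ} (hp : p ∈ Set.Ioo (0 : ℝ) 1)
    (hTpmf : ∀ n : ℕ, 1 ≤ n → (P {ω | T ω = n}).toReal = p * (1 - p) ^ (n - 1)) (n : ℕ) :
    P.real {ω | n < T ω} = (1 - p) ^ n := by
  have hU : {ω | n < T ω} = ⋃ k : ℕ, {ω | T ω = n + 1 + k} := by
    ext ω
    simp only [Set.mem_ofPred_eq, Set.mem_iUnion]
    exact ⟨fun h => ⟨T ω - (n + 1), by omega⟩, fun ⟨k, hk⟩ => by omega⟩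
  have hsum : HasSum (fun k : ℕ => P.real {ω | T ω = n + 1 + k}) (P.real {ω | n < T ω}) := by
    rw [hU]
    have hd : Pairwise (Function.onFun Disjoint fun k : ℕ => {ω | T ω = n + 1 + k}) := by
      intro i j hij
      refine Set.disjoint_left.mpr fun ω hi hj => hij ?_
      simp only [Set.mem_ofPred_eq] at hi hj
      omega
    have hm : ∀ k : ℕ, MeasurableSet {ω | T ω = n + 1 + k} := fun k =>
      hT (measurableSet_singleton (n + 1 + k))
    have hU' := measure_iUnion (μ := P) hd hm
    simp only [measureReal_def]
    rw [hU', ENNReal.tsum_toReal_eq fun k => measure_ne_top P _]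
    exact (ENNReal.summable_toReal (hU' ▸ measure_ne_top P _)).hasSum
  have hgeo : HasSum (fun k : ℕ => p * (1 - p) ^ n * (1 - p) ^ k)
      (p * (1 - p) ^ n * (1 - (1 - p))⁻¹) :=
    (hasSum_geometric_of_lt_one (by linarith [hp.2]) (by linarith [hp.1])).mul_left _
  have heq : (fun k : ℕ => P.real {ω | T ω = n + 1 + k}) =
      fun k : ℕ => p * (1 - p) ^ n * (1 - p) ^ k := by
    funext k
    rw [measureReal_def, hTpmf _ (by omega), show n + 1 + k - 1 = n + k by omega, pow_add, mul_assoc]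
  rw [heq] at hsum
  rw [hsum.unique hgeo, sub_sub_cancel]
  field_simp [hp.1.ne']

/-- The probability generating function is differentiable inside the unit interval,
with the expected derivative. -/
theorem integrable_and_hasDerivAt_integral_pow {Ω : Type*} [MeasurableSpace Ω] (P : Measure Ω)
    [IsProbabilityMeasure P] {X : Ω → ℕ} (hX : Measurable X) {q : ℝ} (hq : q ∈ Set.Ioo (0 : ℝ) 1) :
    Integrable (fun ω => (X ω : ℝ) * q ^ (X ω - 1)) P ∧
      HasDerivAt (fun s : ℝ => ∫ ω, s ^ (X ω) ∂P) (∫ ω, (X ω : ℝ) * q ^ (X ω - 1) ∂P) q := by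
  obtain ⟨r, hqr, hr1⟩ := exists_between hq.2
  have hr0 : 0 < r := hq.1.trans hqr
  obtain ⟨C, hC⟩ := (tendsto_self_mul_const_pow_of_lt_one hr0.le hr1).bddAbove_range
  have hbound : ∀ (n : ℕ) (s : ℝ), s ∈ Set.Ioo 0 r → ‖(n : ℝ) * s ^ (n - 1)‖ ≤ C / r := by
    intro n s hs
    rw [Real.norm_of_nonneg (mul_nonneg n.cast_nonneg (pow_nonneg hs.1.le _)), le_div_iff₀ hr0]
    refine le_trans ?_ (hC ⟨n, rfl⟩)
    rcases n with _ | n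
    · simp
    · simp only [Nat.add_sub_cancel, mul_assoc, pow_succ]
      gcongr
      · exact hs.1.le
      · exact hs.2.le
  have hmeas : ∀ f : ℕ → ℝ, AEStronglyMeasurable (fun ω => f (X ω)) P := fun f =>
    ((measurable_of_countable f).comp hX).aestronglyMeasurable
  refine hasDerivAt_integral_of_dominated_loc_of_deriv_le
    (F := fun s ω => s ^ (X ω)) (F' := fun s ω => (X ω : ℝ) * s ^ (X ω - 1))
    (bound := fun _ => C / r) (s := Set.Ioo 0 r) (Ioo_mem_nhds hq.1 hqr)
    (Filter.Eventually.of_forall fun s => hmeas fun n => s ^ n) ?_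
    (hmeas fun n => (n : ℝ) * q ^ (n - 1))
    (Filter.Eventually.of_forall fun ω s hs => hbound (X ω) s hs) (integrable_const _)
    (Filter.Eventually.of_forall fun ω s _ => hasDerivAt_pow (X ω) s)
  refine Integrable.of_bound (hmeas fun n => q ^ n) 1 (Filter.Eventually.of_forall fun ω => ?_)
  rw [Real.norm_of_nonneg (pow_nonneg hq.1.le _)]
  exact pow_le_one₀ hq.1.le hq.2.le

/-- Integrating out an independent `T` from `X * 1_{X < T}`. -/
theorem integrable_and_integral_censoring {Ω : Type*} [MeasurableSpace Ω] (P : Measure Ω)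
    [IsProbabilityMeasure P] {X T : Ω → ℕ} (hX : Measurable X) (hT : Measurable T)
    (hindep : IndepFun X T P)
    (hint : Integrable (fun ω => (X ω : ℝ) * P.real {ω' | X ω < T ω'}) P) :
    Integrable (fun ω => if X ω < T ω then (X ω : ℝ) else 0) P ∧
      ∫ ω, (if X ω < T ω then (X ω : ℝ) else 0) ∂P =
        ∫ ω, (X ω : ℝ) * P.real {ω' | X ω < T ω'} ∂P := by
  set f : ℕ × ℕ → ℝ := fun z => if z.1 < z.2 then (z.1 : ℝ) else 0 with hf
  have hprod := (indepFun_iff_map_prod_eq_prod_map_map hX.aemeasurable hT.aemeasurable).mp hindep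
  have : IsProbabilityMeasure (P.map X) := Measure.isProbabilityMeasure_map hX.aemeasurable
  have : IsProbabilityMeasure (P.map T) := Measure.isProbabilityMeasure_map hT.aemeasurable
  have hfm : ∀ μ : Measure (ℕ × ℕ), AEStronglyMeasurable f μ := fun μ =>
    (measurable_of_countable f).aestronglyMeasurable
  have hgm : ∀ (g : ℕ → ℝ) (μ : Measure ℕ), AEStronglyMeasurable g μ := fun g μ =>
    (measurable_of_countable g).aestronglyMeasurable
  have hfi : ∀ n : ℕ, ∫ t, f (n, t) ∂(P.map T) = n * P.real {ω | n < T ω} := by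
    intro n
    have : (fun t => f (n, t)) = (Set.Ioi n).indicator fun _ => (n : ℝ) := by
      funext t
      simp [hf, Set.indicator]
    rw [this, integral_indicator_const _ measurableSet_Ioi, smul_eq_mul, mul_comm,
      map_measureReal_apply hT measurableSet_Ioi]
    rfl
  have hnorm : ∀ z, ‖f z‖ = f z := fun z => Real.norm_of_nonneg (by simp only [hf]; positivity)
  have hfint : Integrable f ((P.map X).prod (P.map T)) := by
    rw [integrable_prod_iff (hfm _)]
    refine ⟨Filter.Eventually.of_forall fun n => Integrable.of_bound (hgm _ _) (n : ℝ)
      (Filter.Eventually.of_forall fun t => ?_), ?_⟩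
    · rw [hnorm]
      simp only [hf]
      split_ifs <;> simp
    · simp only [hnorm, hfi]
      exact (integrable_map_measure (hgm _ _) hX.aemeasurable).mpr hint
  have hXT : AEMeasurable (fun ω => (X ω, T ω)) P := (hX.prodMk hT).aemeasurable
  have hfint' := hfint
  rw [← hprod] at hfint'
  refine ⟨(integrable_map_measure (hfm _) hXT).mp hfint', ?_⟩
  calc ∫ ω, (if X ω < T ω then (X ω : ℝ) else 0) ∂P
      = ∫ z, f z ∂(P.map fun ω => (X ω, T ω)) := (integral_map hXT (hfm _)).symm
    _ = ∫ n, ∫ t, f (n, t) ∂(P.map T) ∂(P.map X) := by rw [hprod, integral_prod f hfint]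
    _ = ∫ ω, (X ω : ℝ) * P.real {ω' | X ω < T ω'} ∂P := by
      simp only [hfi]
      exact integral_map hX.aemeasurable (hgm _ _)

/-- If `X ∼ DS(a,λ)` and `Y` is the `p`-censoring of `X`, then
`E[Y] = -a p⁻¹ (1-p) g(1-p) log g(1-p)`, where `g` is the p.g.f. of `X`. -/
theorem censoring_mean_discrete_stable_pgf_form
    {Ω : Type*} [MeasurableSpace Ω] (P : Measure Ω) [IsProbabilityMeasure P]
    (a lam : ℝ) (ha : a ∈ Set.Ioc (0 : ℝ) 1) (hlam : 0 < lam)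
    (X T : Ω → ℕ) (hX : Measurable X) (hT : Measurable T)
    (hpgf : ∀ s ∈ Set.Icc (0 : ℝ) 1,
      (∫ ω, s ^ (X ω) ∂P) = Real.exp (-lam * (1 - s) ^ a))
    (p : ℝ) (hp : p ∈ Set.Ioo (0 : ℝ) 1)
    (hTpmf : ∀ n : ℕ, 1 ≤ n → (P {ω | T ω = n}).toReal = p * (1 - p) ^ (n - 1))
    (hindep : IndepFun X T P)
    (Y : Ω → ℕ) (hY : ∀ ω, Y ω = if X ω < T ω then X ω else 0) :
    Integrable (fun ω => (Y ω : ℝ)) P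
      ∧ (∫ ω, (Y ω : ℝ) ∂P)
          = -a * p⁻¹ * (1 - p) * (∫ ω, (1 - p) ^ (X ω) ∂P)
              * Real.log (∫ ω, (1 - p) ^ (X ω) ∂P) := by
  have hq : 1 - p ∈ Set.Ioo (0 : ℝ) 1 := ⟨by linarith [hp.2], by linarith [hp.1]⟩
  have hp0 : 0 < p := hp.1
  obtain ⟨hint, hderiv⟩ := integrable_and_hasDerivAt_integral_pow P hX hq
  have hfun : (fun ω => (X ω : ℝ) * P.real {ω' | X ω < T ω'}) =
      fun ω => (1 - p) * ((X ω : ℝ) * (1 - p) ^ (X ω - 1)) := by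
    funext ω
    rw [measureReal_lt_of_geometric P hT hp hTpmf]
    rcases X ω with _ | n
    · simp
    · rw [Nat.add_sub_cancel, pow_succ]
      ring
  obtain ⟨hYint, hYeq⟩ := integrable_and_integral_censoring P hX hT hindep
    (hfun ▸ hint.const_mul (1 - p))
  have hYfun : (fun ω => (Y ω : ℝ)) = fun ω => if X ω < T ω then (X ω : ℝ) else 0 := by
    funext ω
    rw [hY]
    push_cast
    rfl
  rw [hYfun]
  refine ⟨hYint, ?_⟩
  have hexp : HasDerivAt (fun s : ℝ => Real.exp (-lam * (1 - s) ^ a))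
      (Real.exp (-lam * (1 - (1 - p)) ^ a) *
        (-lam * (-1 * a * (1 - (1 - p)) ^ (a - 1)))) (1 - p) :=
    ((((hasDerivAt_id (1 - p)).const_sub 1).rpow_const
      (Or.inl (by simp [hp0.ne']))).const_mul (-lam)).exp
  have hev : (fun s : ℝ => ∫ ω, s ^ (X ω) ∂P) =ᶠ[nhds (1 - p)]
      fun s : ℝ => Real.exp (-lam * (1 - s) ^ a) :=
    Filter.mem_of_superset (Icc_mem_nhds hq.1 hq.2) hpgf
  rw [hYeq, hfun, integral_const_mul, hderiv.unique (hexp.congr_of_eventuallyEq hev),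
    hpgf _ (Set.Ioo_subset_Icc_self hq), Real.log_exp, sub_sub_cancel, Real.rpow_sub_one hp0.ne']
  ring
end

section
/- Let μ and ν be probability measures on ℕ with cumulative distribution functions F_μ(x) = μ({0,…,x}) and F_ν(x) = ν({0,…,x}) and probability generating functions g_μ(s) = ∑_n μ({n})s^n and g_ν(s) = ∑_n ν({n})s^n. Then for every s ∈ [0,1), |g_μ(s) − g_ν(s)| ≤ sup_{x∈ℕ} |F_μ(x) − F_ν(x)|. In particular, sup_{p∈(0,1/2]} |g_μ(1−p) − g_ν(1−p)| ≤ sup_{x∈ℕ} |F_μ(x) − F_ν(x)|. -/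
open MeasureTheory

lemma summable_measureReal_mul_pow (μ : Measure ℕ) [IsProbabilityMeasure μ] (A : ℕ → Set ℕ)
    {s : ℝ} (hs : s ∈ Set.Ico (0 : ℝ) 1) : Summable fun n => μ.real (A n) * s ^ n :=
  (summable_geometric_of_lt_one hs.1 hs.2).of_nonneg_of_le
    (fun n => mul_nonneg measureReal_nonneg (pow_nonneg hs.1 n))
    (fun n => mul_le_of_le_one_left (pow_nonneg hs.1 n) measureReal_le_one)

lemma measureReal_Iic_succ (μ : Measure ℕ) [IsProbabilityMeasure μ] (n : ℕ) :
    μ.real (Set.Iic (n + 1)) = μ.real (Set.Iic n) + μ.real {n + 1} := by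
  have h : Set.Iic (n + 1) = Set.Iic n ∪ {n + 1} := by
    ext x
    simp only [Set.mem_Iic, Set.mem_union, Set.mem_singleton_iff]
    omega
  rw [h, measureReal_union (by simp) (measurableSet_singleton _)]

/-- Summation by parts: the generating function in terms of the distribution function. -/
lemma tsum_measureReal_singleton_mul_pow (μ : Measure ℕ) [IsProbabilityMeasure μ]
    {s : ℝ} (hs : s ∈ Set.Ico (0 : ℝ) 1) :
    ∑' n : ℕ, μ.real {n} * s ^ n = (1 - s) * ∑' n : ℕ, μ.real (Set.Iic n) * s ^ n := by
  have hF := summable_measureReal_mul_pow μ Set.Iic hs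
  have ha := summable_measureReal_mul_pow μ (fun n => {n}) hs
  have hF' := (summable_nat_add_iff 1).2 hF
  have h0 : Set.Iic 0 = ({0} : Set ℕ) := by ext; simp
  have key : ∑' n : ℕ, μ.real {n + 1} * s ^ (n + 1)
      = ∑' n : ℕ, μ.real (Set.Iic (n + 1)) * s ^ (n + 1)
        - s * ∑' n : ℕ, μ.real (Set.Iic n) * s ^ n := by
    rw [← tsum_mul_left, ← hF'.tsum_sub (hF.mul_left s)]
    refine tsum_congr fun n => ?_
    rw [measureReal_Iic_succ]
    ring
  have e1 := ha.tsum_eq_zero_add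
  have e2 := hF.tsum_eq_zero_add
  rw [h0] at e2
  linarith

lemma abs_measureReal_sub_le_one (μ ν : Measure ℕ) [IsProbabilityMeasure μ]
    [IsProbabilityMeasure ν] (A : Set ℕ) : |μ.real A - ν.real A| ≤ 1 :=
  abs_sub_le_of_nonneg_of_le measureReal_nonneg measureReal_le_one
    measureReal_nonneg measureReal_le_one

lemma abs_tsum_sub_tsum_le_iSup (μ ν : Measure ℕ) [IsProbabilityMeasure μ]
    [IsProbabilityMeasure ν] {s : ℝ} (hs : s ∈ Set.Ico (0 : ℝ) 1) :
    |(∑' n : ℕ, μ.real {n} * s ^ n) - ∑' n : ℕ, ν.real {n} * s ^ n|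
      ≤ ⨆ x : ℕ, |μ.real (Set.Iic x) - ν.real (Set.Iic x)| := by
  set D := ⨆ x : ℕ, |μ.real (Set.Iic x) - ν.real (Set.Iic x)|
  have hD (x : ℕ) : |μ.real (Set.Iic x) - ν.real (Set.Iic x)| ≤ D :=
    le_ciSup (f := fun x : ℕ => |μ.real (Set.Iic x) - ν.real (Set.Iic x)|)
      ⟨1, Set.forall_mem_range.2 fun x => abs_measureReal_sub_le_one μ ν _⟩ x
  have h1s : 0 < 1 - s := sub_pos.2 hs.2
  rw [tsum_measureReal_singleton_mul_pow μ hs, tsum_measureReal_singleton_mul_pow ν hs,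
    ← mul_sub, ← (summable_measureReal_mul_pow μ Set.Iic hs).tsum_sub
      (summable_measureReal_mul_pow ν Set.Iic hs), abs_mul, abs_of_pos h1s]
  have hb : |∑' n : ℕ, (μ.real (Set.Iic n) * s ^ n - ν.real (Set.Iic n) * s ^ n)|
      ≤ D * (1 - s)⁻¹ := by
    rw [← Real.norm_eq_abs]
    refine tsum_of_norm_bounded ((hasSum_geometric_of_lt_one hs.1 hs.2).mul_left D) fun n => ?_
    rw [← sub_mul, norm_mul, Real.norm_eq_abs, Real.norm_of_nonneg (pow_nonneg hs.1 n)]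
    exact mul_le_mul_of_nonneg_right (hD n) (pow_nonneg hs.1 n)
  calc _ ≤ (1 - s) * (D * (1 - s)⁻¹) := mul_le_mul_of_nonneg_left hb h1s.le
    _ = D := by field_simp

/-- For probability measures `μ, ν` on `ℕ`, the difference of p.g.f.s at any
`s ∈ [0,1)` is bounded by the sup distance of the c.d.f.s; in particular so is
the sup over `p ∈ (0,1/2]` of the differences at `1-p`. -/
theorem pgf_diff_le_sup_cdf_diff
    (μ ν : Measure ℕ) [IsProbabilityMeasure μ] [IsProbabilityMeasure ν] :
    (∀ s ∈ Set.Ico (0 : ℝ) 1,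
        |(∑' n : ℕ, (μ {n}).toReal * s ^ n) - ∑' n : ℕ, (ν {n}).toReal * s ^ n|
          ≤ ⨆ x : ℕ, |(μ (Set.Iic x)).toReal - (ν (Set.Iic x)).toReal|)
      ∧ (⨆ p : Set.Ioc (0 : ℝ) (1 / 2),
            |(∑' n : ℕ, (μ {n}).toReal * (1 - (p : ℝ)) ^ n)
              - ∑' n : ℕ, (ν {n}).toReal * (1 - (p : ℝ)) ^ n|)
          ≤ ⨆ x : ℕ, |(μ (Set.Iic x)).toReal - (ν (Set.Iic x)).toReal| := by
  refine ⟨fun s hs => abs_tsum_sub_tsum_le_iSup μ ν hs, ?_⟩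
  have : Nonempty (Set.Ioc (0 : ℝ) (1 / 2)) := ⟨⟨1 / 2, by norm_num⟩⟩
  refine ciSup_le fun p => abs_tsum_sub_tsum_le_iSup μ ν ⟨?_, ?_⟩
  · linarith [p.2.2]
  · linarith [p.2.1]
end

section
/- Let X have distribution DS(a,λ) with λ > 2^a, and set p = λ^{−1/a}. Then E[X(1−p)^X] and E[X²(1−p)^X] are finite and E[X(1−p)^X] = p·E[X²(1−p)^X]. -/
open MeasureTheory ProbabilityTheory

lemma exp_neg_mul_one_sub_exp_rpow_hasDerivAt (a lam : ℝ) {t : ℝ} (ht : t < 0) :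
    HasDerivAt (fun t => Real.exp (-lam * (1 - Real.exp t) ^ a))
      (Real.exp (-lam * (1 - Real.exp t) ^ a)
        * (lam * a * (Real.exp t * (1 - Real.exp t) ^ (a - 1)))) t := by
  have hpos : 0 < 1 - Real.exp t := sub_pos.2 (Real.exp_lt_one_iff.2 ht)
  have h := ((((Real.hasDerivAt_exp t).const_sub 1).rpow_const (p := a)
    (Or.inl hpos.ne')).const_mul (-lam)).exp
  convert! h using 1
  ring

lemma exp_mul_one_sub_exp_rpow_hasDerivAt (b : ℝ) {t : ℝ} (ht : t < 0) :
    HasDerivAt (fun t => Real.exp t * (1 - Real.exp t) ^ b)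
      (Real.exp t * (1 - Real.exp t) ^ b
        - b * Real.exp t ^ 2 * (1 - Real.exp t) ^ (b - 1)) t := by
  have hpos : 0 < 1 - Real.exp t := sub_pos.2 (Real.exp_lt_one_iff.2 ht)
  have h := (Real.hasDerivAt_exp t).mul
    (((Real.hasDerivAt_exp t).const_sub 1).rpow_const (p := b) (Or.inl hpos.ne'))
  convert! h using 1
  ring

lemma Iio_zero_subset_interior_integrableExpSet_natCast {Ω : Type*} [MeasurableSpace Ω]
    (P : Measure Ω) [IsFiniteMeasure P] {X : Ω → ℕ} (hX : Measurable X) :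
    Set.Iio 0 ⊆ interior (integrableExpSet (fun ω => (X ω : ℝ)) P) := by
  refine interior_maximal (fun t ht => ?_) isOpen_Iio
  refine Integrable.of_bound (by fun_prop) 1 (Filter.Eventually.of_forall fun ω => ?_)
  rw [Real.norm_eq_abs, Real.abs_exp, Real.exp_le_one_iff]
  exact mul_nonpos_of_nonpos_of_nonneg (le_of_lt ht) (Nat.cast_nonneg _)

/-- For `X ∼ DS(a,λ)` with `λ > 2^a` and `p = λ^{-1/a}`, the moments
`E[X(1-p)^X]` and `E[X²(1-p)^X]` are finite and
`E[X(1-p)^X] = p E[X²(1-p)^X]`. -/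
theorem discrete_stable_moment_identity
    {Ω : Type*} [MeasurableSpace Ω] (P : Measure Ω) [IsProbabilityMeasure P]
    (a lam : ℝ) (ha : a ∈ Set.Ioc (0 : ℝ) 1) (hlam : 0 < lam)
    (hlam2 : (2 : ℝ) ^ a < lam)
    (X : Ω → ℕ) (hX : Measurable X)
    (hpgf : ∀ s ∈ Set.Icc (0 : ℝ) 1,
      (∫ ω, s ^ (X ω) ∂P) = Real.exp (-lam * (1 - s) ^ a)) :
    Integrable (fun ω => (X ω : ℝ) * (1 - lam ^ (-a⁻¹ : ℝ)) ^ (X ω)) P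
      ∧ Integrable (fun ω => (X ω : ℝ) ^ 2 * (1 - lam ^ (-a⁻¹ : ℝ)) ^ (X ω)) P
      ∧ (∫ ω, (X ω : ℝ) * (1 - lam ^ (-a⁻¹ : ℝ)) ^ (X ω) ∂P)
          = lam ^ (-a⁻¹ : ℝ)
            * ∫ ω, (X ω : ℝ) ^ 2 * (1 - lam ^ (-a⁻¹ : ℝ)) ^ (X ω) ∂P := by
  obtain ⟨ha0, -⟩ := ha
  set p : ℝ := lam ^ (-a⁻¹ : ℝ) with hp
  have hp0 : 0 < p := Real.rpow_pos_of_pos hlam _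
  have hpa : p ^ a = lam⁻¹ := by
    rw [hp, ← Real.rpow_mul hlam.le, neg_mul, inv_mul_cancel₀ ha0.ne', Real.rpow_neg_one]
  have hp1 : p < 1 :=
    Real.rpow_lt_one_of_one_lt_of_neg ((Real.one_lt_rpow one_lt_two ha0).trans hlam2)
      (neg_neg_of_pos (inv_pos.2 ha0))
  set t₀ : ℝ := Real.log (1 - p) with ht₀
  have hexp : Real.exp t₀ = 1 - p := Real.exp_log (sub_pos.2 hp1)
  have ht₀neg : t₀ < 0 := Real.log_neg (sub_pos.2 hp1) (by linarith)
  have hpow (ω : Ω) : Real.exp (t₀ * (X ω : ℝ)) = (1 - p) ^ X ω := by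
    rw [mul_comm, Real.exp_nat_mul, hexp]
  have hmem {t : ℝ} (ht : t < 0) : t ∈ interior (integrableExpSet (fun ω => (X ω : ℝ)) P) :=
    Iio_zero_subset_interior_integrableExpSet_natCast P hX ht
  have hmgf {t : ℝ} (ht : t < 0) :
      mgf (fun ω => (X ω : ℝ)) P t = Real.exp (-lam * (1 - Real.exp t) ^ a) := by
    rw [← hpgf _ ⟨(Real.exp_pos t).le, (Real.exp_le_one_iff.2 ht.le)⟩, mgf]
    simp_rw [← Real.exp_nat_mul, mul_comm]
  have hfirst {t : ℝ} (ht : t < 0) :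
      ∫ ω, (X ω : ℝ) * Real.exp (t * X ω) ∂P = Real.exp (-lam * (1 - Real.exp t) ^ a)
        * (lam * a * (Real.exp t * (1 - Real.exp t) ^ (a - 1))) := by
    refine (hasDerivAt_mgf (hmem ht)).unique
      ((exp_neg_mul_one_sub_exp_rpow_hasDerivAt a lam ht).congr_of_eventuallyEq ?_)
    filter_upwards [isOpen_Iio.mem_nhds ht] with u hu using hmgf hu
  have hsecond := (hasDerivAt_integral_pow_mul_exp_real (hmem ht₀neg) 1).unique
    (((exp_neg_mul_one_sub_exp_rpow_hasDerivAt a lam ht₀neg).mul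
      ((exp_mul_one_sub_exp_rpow_hasDerivAt (a - 1) ht₀neg).const_mul
        (lam * a))).congr_of_eventuallyEq (by
      filter_upwards [isOpen_Iio.mem_nhds ht₀neg] with u hu
      simpa only [pow_one, Pi.mul_apply] using hfirst hu))
  have hfirst₀ := hfirst ht₀neg
  have hint₁ := integrable_pow_mul_exp_of_mem_interior_integrableExpSet (hmem ht₀neg) 1
  have hint₂ := integrable_pow_mul_exp_of_mem_interior_integrableExpSet (hmem ht₀neg) 2
  simp only [hpow, pow_one] at hint₁ hint₂ hfirst₀
  refine ⟨hint₁, hint₂, ?_⟩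
  simp only [hpow, Nat.reduceAdd] at hsecond
  rw [hfirst₀, hsecond, hexp, sub_sub_cancel]
  simp only [Real.rpow_sub_one hp0.ne', hpa]
  field_simp
  ring
end
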